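/- arXiv:1801.06754 — 2 statements merged into one kernel-verified Lean document; each statement's English description precedes it below -/
import Mathlib

section
/- If the vertex set of a finite simple graph G can be partitioned into two sets each of which induces a forest in G, then the sum-color cost satisfies ŝ(G) ≤ 3·|V(G)|. -/
open Finset

/-- Auxiliary fuelled recursion for the slow-coloring game value.
`slowAux G n S` computes the value of the slow-coloring game on the
subgraph of `G` induced by the set `S` of (uncolored) vertices, provided
`n ≥ S.card`. -/
noncomputable def slowAux {V : Type*} [DecidableEq V] (G : SimpleGraph V) :
    ℕ → Finset V → ℕ
  | 0, _ => 0
  | n + 1, S =>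
      (S.powerset.filter fun M => M.Nonempty).sup fun M =>
        M.card + sInf {k : ℕ | ∃ X : Finset V, X ⊆ M ∧ X.Nonempty ∧
          (∀ x ∈ X, ∀ y ∈ X, ¬ G.Adj x y) ∧ k = slowAux G n (S \ X)}

/-- The sum-color cost `ŝ(G[S])` of the subgraph of `G` induced by the
vertex set `S`. -/
noncomputable def slowCost {V : Type*} [DecidableEq V] (G : SimpleGraph V)
    (S : Finset V) : ℕ :=
  slowAux G S.card S

namespace SimpleGraph

variable {V : Type*}

/-- If the subgraph induced by `s` is acyclic, so is its extension by isolated vertices. -/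
theorem IsAcyclic.spanningCoe_induce {G : SimpleGraph V} {s : Set V}
    (h : (G.induce s).IsAcyclic) : (G.induce s).spanningCoe.IsAcyclic := by
  intro v w hw
  have hs : ∀ x ∈ w.support, x ∈ s := by
    intro x hx
    obtain ⟨e, he, hxe⟩ := (Walk.mem_support_iff_exists_mem_edges_of_not_nil hw.not_nil).1 hx
    have := w.edges_subset_edgeSet he
    induction e with | _ a b =>
    simp only [mem_edgeSet, map_adj, Function.Embedding.subtype_apply] at this
    obtain ⟨a', b', -, rfl, rfl⟩ := this
    rcases Sym2.mem_iff.1 hxe with rfl | rfl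
    exacts [a'.2, b'.2]
  rw [← induce_spanningCoe (G := G.induce s)] at h
  refine h (w.induce s hs) ?_
  refine Walk.IsCycle.of_map (f := (Embedding.induce s).toHom) ?_
  rwa [Walk.map_induce]

/-- In an acyclic graph, two edge-disjoint subgraphs cannot both join two distinct vertices. -/
theorem IsAcyclic.eq_of_reachable_of_disjoint {G H K : SimpleGraph V} (hG : G.IsAcyclic)
    (hH : H ≤ G) (hK : K ≤ G) (hHK : Disjoint H K) {u v : V}
    (hu : H.Reachable u v) (hv : K.Reachable u v) : u = v := by
  obtain ⟨p, hp⟩ := hu.exists_isPath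
  obtain ⟨q, hq⟩ := hv.exists_isPath
  have h := congrArg Subtype.val ((hG.subsingleton_path u v).elim
    ⟨p.mapLe hH, hp.mapLe hH⟩ ⟨q.mapLe hK, hq.mapLe hK⟩)
  have he : p.edges = q.edges := by
    rw [← Walk.edges_mapLe_eq_edges hH, ← Walk.edges_mapLe_eq_edges hK]
    exact congrArg Walk.edges h
  cases p with
  | nil => rfl
  | @cons _ b _ hab p =>
    have hK' : s(u, b) ∈ K.edgeSet := q.edges_subset_edgeSet (he ▸ by simp)
    exact (SimpleGraph.disjoint_left.1 hHK _ _ hab hK').elim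

variable (G : SimpleGraph V)

/-- A family of pairwise disjoint subsets of `S`, each of odd size and each a union of
components of the subgraph of `G` induced by `S`. -/
structure IsOddSplit (S : Finset V) (F : Finset (Finset V)) : Prop where
  subset : ∀ U ∈ F, U ⊆ S
  odd : ∀ U ∈ F, Odd U.card
  closed : ∀ U ∈ F, ∀ a ∈ U, ∀ b ∈ S, G.Adj a b → b ∈ U
  disjoint : (F : Set (Finset V)).PairwiseDisjoint id

open Classical in
/-- The largest size of an odd split of `S`, that is, the number of components of odd order in the
subgraph of `G` induced by `S`. -/
noncomputable def oddSplitNumber (S : Finset V) : ℕ :=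
  (S.powerset.powerset.filter (G.IsOddSplit S)).sup Finset.card

variable {G} {S : Finset V} {F : Finset (Finset V)}

theorem IsOddSplit.card_le_oddSplitNumber (h : G.IsOddSplit S F) :
    F.card ≤ G.oddSplitNumber S := by
  classical
  refine Finset.le_sup (f := Finset.card) (Finset.mem_filter.2 ⟨?_, h⟩)
  exact Finset.mem_powerset.2 fun U hU => Finset.mem_powerset.2 (h.subset U hU)

variable (G S) in
theorem exists_isOddSplit_card_eq :
    ∃ F, G.IsOddSplit S F ∧ F.card = G.oddSplitNumber S := by
  classical
  have hne : (S.powerset.powerset.filter (G.IsOddSplit S)).Nonempty :=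
    ⟨∅, Finset.mem_filter.2 ⟨by simp, by constructor <;> simp⟩⟩
  obtain ⟨F, hF, h⟩ := Finset.exists_mem_eq_sup _ hne Finset.card
  exact ⟨F, (Finset.mem_filter.1 hF).2, h.symm⟩

variable [DecidableEq V]

variable (G S) in
theorem oddSplitNumber_le_card : G.oddSplitNumber S ≤ S.card := by
  obtain ⟨F, hF, h⟩ := exists_isOddSplit_card_eq G S
  rw [← h]
  calc F.card = ∑ U ∈ F, 1 := by simp
    _ ≤ ∑ U ∈ F, U.card := Finset.sum_le_sum fun U hU => (hF.odd U hU).pos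
    _ = (F.biUnion id).card := (Finset.card_biUnion hF.disjoint).symm
    _ ≤ S.card := Finset.card_le_card (Finset.biUnion_subset.2 hF.subset)

variable (G S) in
theorem even_oddSplitNumber_add_card : Even (G.oddSplitNumber S + S.card) := by
  obtain ⟨F, hF, h⟩ := exists_isOddSplit_card_eq G S
  by_contra hodd
  have hsub : F.biUnion id ⊆ S := Finset.biUnion_subset.2 hF.subset
  have hcard : (F.biUnion id).card = ∑ U ∈ F, U.card := Finset.card_biUnion hF.disjoint
  have hpar : (∑ U ∈ F, U.card) % 2 = F.card % 2 := by
    rw [Finset.sum_nat_mod, Finset.sum_congr rfl fun U hU => Nat.odd_iff.1 (hF.odd U hU)]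
    simp
  have hrest := Finset.card_sdiff_add_card_eq_card hsub
  have hodd' : Odd (S \ F.biUnion id).card := by
    rw [Nat.odd_iff]
    rw [Nat.even_iff] at hodd
    omega
  have hdis : ∀ U ∈ F, Disjoint (S \ F.biUnion id) U := fun U hU =>
    Finset.sdiff_disjoint.mono_right (Finset.subset_biUnion_of_mem id hU)
  have hnot : S \ F.biUnion id ∉ F := fun hmem => by
    have := Finset.disjoint_self_iff_empty _ |>.1 (hdis _ hmem)
    rw [this] at hodd'
    simp at hodd'
  have hsplit : G.IsOddSplit S (insert (S \ F.biUnion id) F) := by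
    refine ⟨?_, ?_, ?_, ?_⟩
    · exact (Finset.forall_mem_insert _ _ _).2 ⟨Finset.sdiff_subset, hF.subset⟩
    · exact (Finset.forall_mem_insert _ _ _).2 ⟨hodd', hF.odd⟩
    · intro U hU a ha b hb hab
      rcases Finset.mem_insert.1 hU with rfl | hU
      · rw [Finset.mem_sdiff] at ha ⊢
        refine ⟨hb, fun hb' => ha.2 ?_⟩
        obtain ⟨W, hW, hbW⟩ := Finset.mem_biUnion.1 hb'
        exact Finset.mem_biUnion.2 ⟨W, hW, hF.closed W hW b hbW a ha.1 hab.symm⟩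
      · exact hF.closed U hU a ha b hb hab
    · rw [Finset.coe_insert]
      exact hF.disjoint.insert fun U hU _ => hdis U hU
  have := hsplit.card_le_oddSplitNumber
  rw [Finset.card_insert_of_notMem hnot] at this
  omega

/-- Painter's response to a marked set `M` that induces a tree. -/
theorem IsAcyclic.exists_response_of_connected (hG : G.IsAcyclic) {M : Finset V} (hMS : M ⊆ S)
    (hne : M.Nonempty)
    (hconn : ∀ N ⊆ M, N.Nonempty → (∀ a ∈ N, ∀ b ∈ M, G.Adj a b → b ∈ N) → N = M) :
    ∃ X ⊆ M, (∀ x ∈ X, ∀ y ∈ X, ¬ G.Adj x y) ∧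
      2 * M.card + G.oddSplitNumber S ≤ 3 * X.card + G.oddSplitNumber (S \ X) := by
  classical
  obtain ⟨c⟩ := hG.colorable_two
  obtain ⟨F, hF, hFcard⟩ := exists_isOddSplit_card_eq G S
  have hMU : ∀ U ∈ F, ¬ Disjoint U M → M ⊆ U := by
    intro U hU hUM
    have := hconn (U ∩ M) Finset.inter_subset_right
      (Finset.not_disjoint_iff_nonempty_inter.1 hUM) fun a ha b hb hab => by
        rw [Finset.mem_inter] at ha ⊢
        exact ⟨hF.closed U hU a ha.1 b (hMS hb) hab, hb⟩
    exact Finset.inter_eq_right.1 this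
  have hbad : (F.filter fun U => ¬ Disjoint U M).card ≤ 1 := by
    refine Finset.card_le_one.2 fun U hU W hW => ?_
    simp only [Finset.mem_filter] at hU hW
    by_contra hUW
    obtain ⟨v, hv⟩ := hne
    exact Finset.disjoint_left.1 (hF.disjoint hU.1 hW.1 hUW) (hMU U hU.1 hU.2 hv)
      (hMU W hW.1 hW.2 hv)
  have hsum := Finset.card_filter_add_card_filter_not (s := F) (fun U => Disjoint U M)
  set F' := F.filter fun U => Disjoint U M
  let K : SimpleGraph V :=
    { Adj := fun a b => G.Adj a b ∧ a ∈ M ∧ b ∈ M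
      symm := ⟨fun a b h => ⟨h.1.symm, h.2.2, h.2.1⟩⟩
      loopless := ⟨fun a h => G.loopless.irrefl a h.1⟩ }
  let H : SimpleGraph V :=
    { Adj := fun a b => G.Adj a b ∧ (a ∈ S ∧ b ∈ S) ∧ ¬ (a ∈ M ∧ b ∈ M)
      symm := ⟨fun a b h => ⟨h.1.symm, h.2.1.symm, fun h' => h.2.2 h'.symm⟩⟩
      loopless := ⟨fun a h => G.loopless.irrefl a h.1⟩ }
  have hKreach : ∀ u ∈ M, ∀ v ∈ M, K.Reachable u v := by
    intro u hu v hv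
    have := hconn (M.filter fun w => K.Reachable u w) (Finset.filter_subset _ _)
      ⟨u, by simp [hu]⟩ fun a ha b hb hab => by
        simp only [Finset.mem_filter] at ha ⊢
        exact ⟨hb, ha.2.trans (Adj.reachable (G := K) ⟨hab, ha.1, hb⟩)⟩
    rw [← this] at hv
    exact (Finset.mem_filter.1 hv).2
  have hHeq : ∀ u ∈ M, ∀ v ∈ M, H.Reachable u v → u = v := fun u hu v hv h =>
    hG.eq_of_reachable_of_disjoint (H := H) (K := K) (fun _ _ h => h.1) (fun _ _ h => h.1)
      (SimpleGraph.disjoint_left.2 fun _ _ h h' => h.2.2 h'.2) h (hKreach u hu v hv)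
  let T : V → Finset V := fun v => S.filter fun u => H.Reachable v u
  have hTmem : ∀ v u, u ∈ T v ↔ u ∈ S ∧ H.Reachable v u := fun v u => Finset.mem_filter
  have hself : ∀ v ∈ M, v ∈ T v := fun v hv => (hTmem v v).2 ⟨hMS hv, Reachable.refl v⟩
  have hTdisj : ∀ v ∈ M, ∀ w ∈ M, v ≠ w → Disjoint (T v) (T w) := by
    intro v hv w hw hvw
    refine Finset.disjoint_left.2 fun u hu hu' => hvw (hHeq v hv w hw ?_)
    exact ((hTmem v u).1 hu).2.trans ((hTmem w u).1 hu').2.symm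
  have hTF : ∀ U ∈ F', ∀ v ∈ M, Disjoint U (T v) := by
    intro U hU v hv
    obtain ⟨hU, hUM⟩ := Finset.mem_filter.1 hU
    refine Finset.disjoint_right.2 fun u hu huU => ?_
    obtain ⟨-, ⟨p⟩⟩ := (hTmem v u).1 hu
    have key : ∀ {a b : V}, H.Walk a b → b ∈ U → a ∈ U := by
      intro a b p
      induction p with
      | nil => exact id
      | cons h p ih => exact fun hb => hF.closed U hU _ (ih hb) _ h.2.1.1 h.1.symm
    exact Finset.disjoint_left.1 hUM (key p huU) hv
  let E : Fin 2 → V → Finset V := fun i v => if c v = i then (T v).erase v else T v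
  have hET : ∀ i v, E i v ⊆ T v := by
    intro i v
    by_cases h : c v = i
    · simpa [E, h] using Finset.erase_subset _ _
    · simp [E, h]
  let X : Fin 2 → Finset V := fun i => M.filter fun v => c v = i
  let O : Fin 2 → Finset V := fun i => M.filter fun v => Odd (E i v).card
  have hXsum : (X 0).card + (X 1).card = M.card := by
    have : X 1 = M.filter fun v => ¬ c v = 0 :=
      Finset.filter_congr fun v _ => by generalize c v = j; fin_cases j <;> simp
    rw [this]
    exact Finset.card_filter_add_card_filter_not _
  have hOsum : (O 0).card + (O 1).card = M.card := by
    have : O 1 = M.filter fun v => ¬ Odd (E 0 v).card := by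
      refine Finset.filter_congr fun v hv => ?_
      have h1 : Odd (T v).card ↔ ¬ Odd ((T v).erase v).card := by
        rw [← Finset.card_erase_add_one (hself v hv), Nat.odd_add_one]
      have h2 : c v = 0 ∨ c v = 1 := by generalize c v = j; fin_cases j <;> simp
      rcases h2 with h2 | h2 <;> simp [E, h2, h1]
    rw [this]
    exact Finset.card_filter_add_card_filter_not _
  have hbound : ∀ i, F'.card + (O i).card ≤ G.oddSplitNumber (S \ X i) := by
    intro i
    have hEdisj : ∀ v ∈ O i, ∀ w ∈ O i, v ≠ w → Disjoint (E i v) (E i w) := fun v hv w hw hvw =>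
      (hTdisj v (Finset.mem_filter.1 hv).1 w (Finset.mem_filter.1 hw).1 hvw).mono
        (hET i v) (hET i w)
    have hEne : ∀ v ∈ O i, E i v ≠ ∅ := fun v hv h => by
      have := (Finset.mem_filter.1 hv).2
      simp [h] at this
    have hinj : Set.InjOn (E i) (O i) := fun v hv w hw hvw => by
      by_contra hne
      have := hEdisj v hv w hw hne
      rw [← hvw, Finset.disjoint_self_iff_empty] at this
      exact hEne v hv this
    have hEF : ∀ U ∈ F', ∀ v ∈ O i, Disjoint U (E i v) := fun U hU v hv =>
      (hTF U hU v (Finset.mem_filter.1 hv).1).mono_right (hET i v)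
    have hFE : Disjoint F' ((O i).image (E i)) := by
      refine Finset.disjoint_right.2 fun U hU hUF => ?_
      obtain ⟨v, hv, rfl⟩ := Finset.mem_image.1 hU
      exact hEne v hv ((Finset.disjoint_self_iff_empty _).1 (hEF _ hUF v hv))
    have hEX : ∀ v ∈ M, Disjoint (E i v) (X i) := by
      refine fun v hv => Finset.disjoint_left.2 fun u hu huX => ?_
      obtain ⟨huM, hui⟩ := Finset.mem_filter.1 huX
      obtain rfl := hHeq v hv u huM ((hTmem v u).1 (hET i v hu)).2
      simp [E, hui] at hu
    rw [← Finset.card_image_of_injOn hinj, ← Finset.card_union_of_disjoint hFE]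
    refine IsOddSplit.card_le_oddSplitNumber ⟨?_, ?_, ?_, ?_⟩
    · intro U hU
      rcases Finset.mem_union.1 hU with hU | hU
      · obtain ⟨hU, hUM⟩ := Finset.mem_filter.1 hU
        exact Finset.subset_sdiff.2
          ⟨hF.subset U hU, hUM.mono_right (Finset.filter_subset _ _)⟩
      · obtain ⟨v, hv, rfl⟩ := Finset.mem_image.1 hU
        exact Finset.subset_sdiff.2 ⟨(hET i v).trans (Finset.filter_subset _ _),
          hEX v (Finset.mem_filter.1 hv).1⟩
    · intro U hU
      rcases Finset.mem_union.1 hU with hU | hU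
      · exact hF.odd U (Finset.mem_filter.1 hU).1
      · obtain ⟨v, hv, rfl⟩ := Finset.mem_image.1 hU
        exact (Finset.mem_filter.1 hv).2
    · intro U hU a ha b hb hab
      obtain ⟨hbS, hbX⟩ := Finset.mem_sdiff.1 hb
      rcases Finset.mem_union.1 hU with hU | hU
      · exact hF.closed U (Finset.mem_filter.1 hU).1 a ha b hbS hab
      · obtain ⟨v, hv, rfl⟩ := Finset.mem_image.1 hU
        obtain ⟨hvM, -⟩ := Finset.mem_filter.1 hv
        obtain ⟨haS, hva⟩ := (hTmem v a).1 (hET i v ha)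
        by_cases hM : a ∈ M ∧ b ∈ M
        · obtain rfl := hHeq v hvM a hM.1 hva
          have h1 : c v ≠ i := fun h =>
            Finset.disjoint_left.1 (hEX v hvM) ha (Finset.mem_filter.2 ⟨hvM, h⟩)
          have h2 : c b ≠ i := fun h => hbX (Finset.mem_filter.2 ⟨hM.2, h⟩)
          have h3 := c.valid hab
          omega
        · have hbT : b ∈ T v :=
            (hTmem v b).2 ⟨hbS, hva.trans (Adj.reachable (G := H) ⟨hab, ⟨haS, hbS⟩, hM⟩)⟩
          by_cases h : c v = i
          · have hbv : b ≠ v := by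
              rintro rfl
              exact hbX (Finset.mem_filter.2 ⟨hvM, h⟩)
            simpa [E, h] using ⟨hbv, hbT⟩
          · simpa [E, h] using hbT
    · intro U hU W hW hUW
      rcases Finset.mem_union.1 hU with hU | hU <;> rcases Finset.mem_union.1 hW with hW | hW
      · exact hF.disjoint (Finset.mem_filter.1 hU).1 (Finset.mem_filter.1 hW).1 hUW
      · obtain ⟨v, hv, rfl⟩ := Finset.mem_image.1 hW
        exact hEF U hU v hv
      · obtain ⟨v, hv, rfl⟩ := Finset.mem_image.1 hU
        exact (hEF W hW v hv).symm
      · obtain ⟨v, hv, rfl⟩ := Finset.mem_image.1 hU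
        obtain ⟨w, hw, rfl⟩ := Finset.mem_image.1 hW
        exact hEdisj v hv w hw fun h => hUW (h ▸ rfl)
  have hpick : ∃ i, 2 * M.card ≤ 3 * (X i).card + (O i).card := by
    by_contra! h
    have h0 := h 0
    have h1 := h 1
    omega
  obtain ⟨i, hi⟩ := hpick
  refine ⟨X i, Finset.filter_subset _ _, fun x hx y hy hxy => c.valid hxy ?_, ?_⟩
  · rw [(Finset.mem_filter.1 hx).2, (Finset.mem_filter.1 hy).2]
  · have h1 := hbound i
    have h2 := even_oddSplitNumber_add_card G S
    have h3 := even_oddSplitNumber_add_card G (S \ X i)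
    have h4 := Finset.card_sdiff_add_card_eq_card
      (show X i ⊆ S from (Finset.filter_subset _ _).trans hMS)
    rw [Nat.even_iff] at h2 h3
    omega

/-- Painter's response to an arbitrary marked set `M` in a forest. -/
theorem IsAcyclic.exists_response (hG : G.IsAcyclic) {M : Finset V} (hMS : M ⊆ S) :
    ∃ X ⊆ M, (∀ x ∈ X, ∀ y ∈ X, ¬ G.Adj x y) ∧
      2 * M.card + G.oddSplitNumber S ≤ 3 * X.card + G.oddSplitNumber (S \ X) := by
  induction M using Finset.strongInduction generalizing S with
  | H M ih =>
  rcases M.eq_empty_or_nonempty with rfl | hne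
  · exact ⟨∅, by simp⟩
  by_cases hconn : ∀ N ⊆ M, N.Nonempty → (∀ a ∈ N, ∀ b ∈ M, G.Adj a b → b ∈ N) → N = M
  · exact hG.exists_response_of_connected hMS hne hconn
  push Not at hconn
  obtain ⟨N, hNM, hN, hclosed, hNe⟩ := hconn
  obtain ⟨X, hXN, hX, hXcard⟩ := ih N (hNM.ssubset_of_ne hNe) (hNM.trans hMS)
  obtain ⟨Y, hYN, hY, hYcard⟩ := ih (M \ N) (Finset.sdiff_ssubset hNM hN) (S := S \ X)
    (Finset.sdiff_subset_sdiff hMS hXN)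
  have hcross : ∀ x ∈ X, ∀ y ∈ Y, ¬ G.Adj x y := fun x hx y hy hxy =>
    (Finset.mem_sdiff.1 (hYN hy)).2
      (hclosed x (hXN hx) y (Finset.mem_sdiff.1 (hYN hy)).1 hxy)
  refine ⟨X ∪ Y, Finset.union_subset (hXN.trans hNM) (hYN.trans Finset.sdiff_subset), ?_, ?_⟩
  · intro x hx y hy hxy
    rcases Finset.mem_union.1 hx with hx | hx <;> rcases Finset.mem_union.1 hy with hy | hy
    · exact hX x hx y hy hxy
    · exact hcross x hx y hy hxy
    · exact hcross y hy x hx hxy.symm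
    · exact hY x hx y hy hxy
  · have hdisj : Disjoint X Y := Finset.disjoint_sdiff.mono hXN hYN
    have hcard := Finset.card_sdiff_add_card_eq_card hNM
    rw [sdiff_sdiff_left, Finset.sup_eq_union] at hYcard
    rw [Finset.card_union_of_disjoint hdisj]
    omega

end SimpleGraph

/-- Painter answers in whichever of the two forests contains more of the marked vertices. -/
theorem slowAux_add_oddSplitNumber_le {V : Type*} [DecidableEq V] (G : SimpleGraph V)
    {A B : Finset V} (hdisj : Disjoint A B)
    (hA : (G.induce (A : Set V)).IsAcyclic) (hB : (G.induce (B : Set V)).IsAcyclic)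
    (n : ℕ) {S : Finset V} (hS : S ⊆ A ∪ B) :
    slowAux G n S + (G.induce (A : Set V)).spanningCoe.oddSplitNumber (S ∩ A) +
      (G.induce (B : Set V)).spanningCoe.oddSplitNumber (S ∩ B) ≤ 3 * S.card := by
  have hcard : ∀ T ⊆ A ∪ B, (T ∩ A).card + (T ∩ B).card = T.card := fun T hT => by
    rw [← Finset.card_union_of_disjoint (hdisj.mono inter_subset_right inter_subset_right),
      ← Finset.inter_union_distrib_left, Finset.inter_eq_left.2 hT]
  have hoA : ∀ T, (G.induce (A : Set V)).spanningCoe.oddSplitNumber T ≤ T.card :=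
    fun T => SimpleGraph.oddSplitNumber_le_card _ T
  have hoB : ∀ T, (G.induce (B : Set V)).spanningCoe.oddSplitNumber T ≤ T.card :=
    fun T => SimpleGraph.oddSplitNumber_le_card _ T
  induction n generalizing S with
  | zero =>
    have h1 := hcard S hS
    have h2 := hoA (S ∩ A)
    have h3 := hoB (S ∩ B)
    simp only [slowAux]
    omega
  | succ n ih =>
    have hrespond : ∀ {C D M : Finset V}, Disjoint C D → (G.induce (C : Set V)).IsAcyclic →
        M ⊆ S → M.Nonempty → M.card ≤ 2 * (M ∩ C).card →
        ∃ X ⊆ M, X.Nonempty ∧ (∀ x ∈ X, ∀ y ∈ X, ¬ G.Adj x y) ∧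
          (S \ X) ∩ D = S ∩ D ∧
          M.card + (G.induce (C : Set V)).spanningCoe.oddSplitNumber (S ∩ C) ≤
            3 * X.card + (G.induce (C : Set V)).spanningCoe.oddSplitNumber ((S \ X) ∩ C) := by
      intro C D M hCD hC hM hne hMC
      obtain ⟨X, hXM, hX, hXcard⟩ := hC.spanningCoe_induce.exists_response
        (inter_subset_inter_right hM : M ∩ C ⊆ S ∩ C)
      have hXC : X ⊆ C := hXM.trans inter_subset_right
      have hsdiff : (S \ X) ∩ C = (S ∩ C) \ X := by
        ext v
        simp only [mem_inter, mem_sdiff]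
        tauto
      refine ⟨X, hXM.trans inter_subset_left, ?_, fun x hx y hy hxy => hX x hx y hy ?_, ?_, ?_⟩
      · rw [nonempty_iff_ne_empty]
        rintro rfl
        have := hne.card_pos
        simp only [card_empty, sdiff_empty] at hXcard
        omega
      · exact ⟨hxy.ne, ⟨x, hXC hx⟩, ⟨y, hXC hy⟩, hxy, rfl, rfl⟩
      · ext v
        have hv : v ∈ X → v ∉ D := fun h => disjoint_left.1 hCD (hXC h)
        simp only [mem_inter, mem_sdiff]
        tauto
      · rw [hsdiff]
        omega
    have hsup : slowAux G (n + 1) S ≤ 3 * S.card -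
        ((G.induce (A : Set V)).spanningCoe.oddSplitNumber (S ∩ A) +
          (G.induce (B : Set V)).spanningCoe.oddSplitNumber (S ∩ B)) := by
      simp only [slowAux]
      refine Finset.sup_le fun M hM => ?_
      obtain ⟨hMS, hne⟩ := mem_filter.1 hM
      rw [mem_powerset] at hMS
      have hsplit := hcard M (hMS.trans hS)
      have hchoose : ∃ X ⊆ M, X.Nonempty ∧ (∀ x ∈ X, ∀ y ∈ X, ¬ G.Adj x y) ∧
          M.card + ((G.induce (A : Set V)).spanningCoe.oddSplitNumber (S ∩ A) +
            (G.induce (B : Set V)).spanningCoe.oddSplitNumber (S ∩ B)) ≤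
          3 * X.card + ((G.induce (A : Set V)).spanningCoe.oddSplitNumber ((S \ X) ∩ A) +
            (G.induce (B : Set V)).spanningCoe.oddSplitNumber ((S \ X) ∩ B)) := by
        rcases le_total (M ∩ B).card (M ∩ A).card with h | h
        · obtain ⟨X, h1, h2, h3, h4, h5⟩ := hrespond hdisj hA hMS hne (by omega)
          exact ⟨X, h1, h2, h3, by rw [h4]; omega⟩
        · obtain ⟨X, h1, h2, h3, h4, h5⟩ := hrespond hdisj.symm hB hMS hne (by omega)
          exact ⟨X, h1, h2, h3, by rw [h4]; omega⟩
      obtain ⟨X, hXM, hXne, hX, hXcard⟩ := hchoose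
      have hinf := Nat.sInf_le (s := {k : ℕ | ∃ X : Finset V, X ⊆ M ∧ X.Nonempty ∧
          (∀ x ∈ X, ∀ y ∈ X, ¬ G.Adj x y) ∧ k = slowAux G n (S \ X)})
        ⟨X, hXM, hXne, hX, rfl⟩
      have hrec := ih (sdiff_subset.trans hS : S \ X ⊆ A ∪ B)
      have hXS := card_sdiff_add_card_eq_card (hXM.trans hMS)
      omega
    have h1 := hcard S hS
    have h2 := hoA (S ∩ A)
    have h3 := hoB (S ∩ B)
    omega

theorem stmt_12 {V : Type*} [Fintype V] [DecidableEq V] (G : SimpleGraph V)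
    (A B : Finset V) (hdisj : Disjoint A B) (hcover : ∀ v : V, v ∈ A ∨ v ∈ B)
    (hAforest : (G.induce (↑A : Set V)).IsAcyclic)
    (hBforest : (G.induce (↑B : Set V)).IsAcyclic) :
    (slowCost G Finset.univ : ℝ) ≤ 3 * Fintype.card V := by
  have h := slowAux_add_oddSplitNumber_le G hdisj hAforest hBforest (univ : Finset V).card
    (S := univ) (fun v _ => mem_union.2 (hcover v))
  have h' : slowCost G univ ≤ 3 * Fintype.card V := by
    rw [card_univ] at h
    simp only [slowCost, card_univ]
    omega
  exact_mod_cast h'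
end

section
/- Let G be a 4-colorable finite simple graph (chromatic number at most 4) and let M ⊆ V(G) be a nonempty set such that the induced subgraph G[M] is connected. Then there exist independent sets V'_1, V'_2, V'_3, V'_4 of G, each contained in M and with union equal to M, such that Σ_{i=1}^{4} ( Φ(G) − Φ(G − V'_i) ) ≥ 4·|M|, where Φ(H) = Σ_{v ∈ V(H)} ( 1 + (1/5)·min(d_H(v), 3) ) + (3/5)·|E(H)| and G − X is the graph obtained from G by deleting the vertices of X. -/
open Finset

/-- The potential `Φ(H) = Σ_v (1 + (1/5)·min(d_H(v),3)) + (3/5)·|E(H)|`. -/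
noncomputable def Phi {W : Type*} [Fintype W] (H : SimpleGraph W) : ℝ :=
  (∑ v : W, (1 + (1 / 5 : ℝ) * (min ((H.neighborSet v).ncard) 3 : ℕ))) +
    (3 / 5 : ℝ) * (H.edgeSet.ncard : ℝ)

/-- The potential in terms of degrees only, using the handshake lemma. -/
theorem Phi_eq_sum_degree {W : Type*} [Fintype W] (H : SimpleGraph W) [DecidableRel H.Adj] :
    Phi H = ∑ v, (1 + (1 / 5 : ℝ) * (min (H.degree v) 3 : ℕ) + 3 / 10 * (H.degree v : ℝ)) := by
  classical
  have hdeg (v : W) : (H.neighborSet v).ncard = H.degree v := by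
    rw [Set.ncard_eq_toFinset_card', ← SimpleGraph.neighborFinset_def,
      SimpleGraph.card_neighborFinset_eq_degree]
  have hedge : H.edgeSet.ncard = #H.edgeFinset := by
    rw [Set.ncard_eq_toFinset_card', SimpleGraph.edgeFinset]
  have hsum : (∑ v, (H.degree v : ℝ)) = 2 * (#H.edgeFinset : ℝ) := by
    exact_mod_cast H.sum_degrees_eq_twice_card_edges
  unfold Phi
  simp only [hdeg, hedge]
  simp only [Finset.sum_add_distrib, ← Finset.mul_sum, hsum]
  ring

section Induced

variable {V : Type*} [Fintype V] [DecidableEq V] (G : SimpleGraph V) [DecidableRel G.Adj]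

theorem degree_induce_eq_card_inter (S : Finset V) [Fintype (↑S : Set V)]
    (v : (↑S : Set V)) :
    (G.induce (↑S : Set V)).degree v = #(G.neighborFinset v ∩ S) := by
  rw [← SimpleGraph.card_neighborFinset_eq_degree,
    ← Finset.card_map (Function.Embedding.subtype _)]
  congr 1
  ext w
  simp [and_comm]

theorem Phi_induce_eq_sum (S : Finset V) [Fintype (↑S : Set V)] :
    Phi (G.induce (↑S : Set V)) =
      ∑ v ∈ S, (1 + (1 / 5 : ℝ) * (min #(G.neighborFinset v ∩ S) 3 : ℕ) +
        3 / 10 * (#(G.neighborFinset v ∩ S) : ℝ)) := by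
  rw [Phi_eq_sum_degree]
  simp only [degree_induce_eq_card_inter]
  exact (Finset.sum_subtype S (fun _ => Iff.rfl) fun v =>
    (1 + (1 / 5 : ℝ) * (min #(G.neighborFinset v ∩ S) 3 : ℕ) +
        3 / 10 * (#(G.neighborFinset v ∩ S) : ℝ))).symm

theorem sum_card_neighborFinset_inter_comm (X Y : Finset V) :
    ∑ v ∈ Y, #(G.neighborFinset v ∩ X) = ∑ v ∈ X, #(G.neighborFinset v ∩ Y) := by
  have h (X Y : Finset V) : ∑ v ∈ Y, #(G.neighborFinset v ∩ X) =
      ∑ v ∈ Y, ∑ u ∈ X, if G.Adj v u then 1 else 0 := by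
    refine Finset.sum_congr rfl fun v _ => ?_
    rw [← Finset.card_filter]
    congr 1
    ext u
    simp [and_comm]
  rw [h, h, Finset.sum_comm]
  simp only [G.adj_comm]

/-- A lower bound on the drop of the potential when deleting an independent set. -/
theorem sum_le_Phi_sub_Phi_induce (X : Finset V)
    (hX : ∀ x ∈ X, ∀ y ∈ X, ¬ G.Adj x y) [Fintype (↑(univ \ X) : Set V)] :
    ∑ v, ((if v ∈ X then 1 + (1 / 5 : ℝ) * (min (G.degree v) 3 : ℕ) + 3 / 5 * (G.degree v : ℝ)
        else 0) + if G.degree v ≤ 3 then 1 / 5 * (#(G.neighborFinset v ∩ X) : ℝ) else 0) ≤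
      Phi G - Phi (G.induce (↑(univ \ X) : Set V)) := by
  have hsplit (v : V) : #(G.neighborFinset v ∩ (univ \ X)) + #(G.neighborFinset v ∩ X) =
      G.degree v := by
    rw [← SimpleGraph.card_neighborFinset_eq_degree,
      ← Finset.card_inter_add_card_sdiff (G.neighborFinset v) X, add_comm]
    congr 2
    ext u
    simp
  have hzero (v : V) (hv : v ∈ X) : #(G.neighborFinset v ∩ X) = 0 := by
    rw [Finset.card_eq_zero, Finset.eq_empty_iff_forall_notMem]
    intro u hu
    rw [Finset.mem_inter, SimpleGraph.mem_neighborFinset] at hu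
    exact hX v hv u hu.2 hu.1
  have hcross : ∑ v ∈ univ \ X, (#(G.neighborFinset v ∩ X) : ℝ) =
      ∑ v ∈ X, (G.degree v : ℝ) := by
    have h : ∑ v ∈ univ \ X, #(G.neighborFinset v ∩ X) = ∑ v ∈ X, G.degree v := by
      rw [sum_card_neighborFinset_inter_comm]
      refine Finset.sum_congr rfl fun v hv => ?_
      rw [← hsplit v, hzero v hv, add_zero]
    exact_mod_cast h
  rw [Phi_eq_sum_degree, Phi_induce_eq_sum, ← Finset.sum_sdiff (Finset.subset_univ X),
    ← Finset.sum_sdiff (Finset.subset_univ X)]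
  have hin : ∑ v ∈ X, ((if v ∈ X then 1 + (1 / 5 : ℝ) * (min (G.degree v) 3 : ℕ) +
        3 / 5 * (G.degree v : ℝ) else 0) +
          if G.degree v ≤ 3 then 1 / 5 * (#(G.neighborFinset v ∩ X) : ℝ) else 0) =
      ∑ v ∈ X, (1 + (1 / 5 : ℝ) * (min (G.degree v) 3 : ℕ) + 3 / 10 * (G.degree v : ℝ)) +
        3 / 10 * ∑ v ∈ X, (G.degree v : ℝ) := by
    rw [Finset.mul_sum, ← Finset.sum_add_distrib]
    refine Finset.sum_congr rfl fun v hv => ?_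
    simp only [hv, if_true, hzero v hv, Nat.cast_zero, mul_zero, ite_self]
    ring
  have hout : ∑ v ∈ univ \ X, ((if v ∈ X then 1 + (1 / 5 : ℝ) * (min (G.degree v) 3 : ℕ) +
        3 / 5 * (G.degree v : ℝ) else 0) +
          if G.degree v ≤ 3 then 1 / 5 * (#(G.neighborFinset v ∩ X) : ℝ) else 0) +
      ∑ v ∈ univ \ X, (1 + (1 / 5 : ℝ) * (min #(G.neighborFinset v ∩ (univ \ X)) 3 : ℕ) +
        3 / 10 * (#(G.neighborFinset v ∩ (univ \ X)) : ℝ)) +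
      3 / 10 * ∑ v ∈ univ \ X, (#(G.neighborFinset v ∩ X) : ℝ) ≤
      ∑ v ∈ univ \ X, (1 + (1 / 5 : ℝ) * (min (G.degree v) 3 : ℕ) +
        3 / 10 * (G.degree v : ℝ)) := by
    rw [Finset.mul_sum, ← Finset.sum_add_distrib, ← Finset.sum_add_distrib]
    refine Finset.sum_le_sum fun v hv => ?_
    have hv' : v ∉ X := (Finset.mem_sdiff.1 hv).2
    have hs := hsplit v
    have hs' : (#(G.neighborFinset v ∩ (univ \ X)) : ℝ) + #(G.neighborFinset v ∩ X) =
      G.degree v := by exact_mod_cast hs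
    rw [if_neg hv']
    split_ifs with hd
    · rw [min_eq_left hd, min_eq_left (by lia : #(G.neighborFinset v ∩ (univ \ X)) ≤ 3)]
      linarith
    · have hm : ((min #(G.neighborFinset v ∩ (univ \ X)) 3 : ℕ) : ℝ) ≤
          (min (G.degree v) 3 : ℕ) := by
        exact_mod_cast min_le_min_right 3 (by lia)
      linarith
  linarith

end Induced

/-- Every independent subset of `M` extends to an independent subset of `M` dominating `M`. -/
theorem exists_dominating_independent {V : Type*} (G : SimpleGraph V)
    (M A : Finset V) (hAM : A ⊆ M) (hA : ∀ x ∈ A, ∀ y ∈ A, ¬ G.Adj x y) :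
    ∃ B, A ⊆ B ∧ B ⊆ M ∧ (∀ x ∈ B, ∀ y ∈ B, ¬ G.Adj x y) ∧
      ∀ v ∈ M, v ∈ B ∨ ∃ u ∈ B, G.Adj v u := by
  classical
  let s := M.powerset.filter fun B => ∀ x ∈ B, ∀ y ∈ B, ¬ G.Adj x y
  obtain ⟨B, hAB, hB⟩ := s.exists_le_maximal (a := A) (by simpa [s, hAM] using hA)
  have hBs := hB.prop
  simp only [s, Finset.mem_filter, Finset.mem_powerset] at hBs
  refine ⟨B, hAB, hBs.1, hBs.2, fun v hv => ?_⟩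
  by_contra! hcon
  refine hcon.1 (hB.le_of_ge (y := insert v B) ?_ (Finset.subset_insert v B)
    (Finset.mem_insert_self v B))
  simp only [s, Finset.mem_filter, Finset.mem_powerset]
  refine ⟨Finset.insert_subset hv hBs.1, fun x hx y hy => ?_⟩
  rcases Finset.mem_insert.1 hx with rfl | hxB <;> rcases Finset.mem_insert.1 hy with rfl | hyB
  · exact G.irrefl
  · exact hcon.2 y hyB
  · exact fun h => hcon.2 x hxB h.symm
  · exact hBs.2 x hxB y hyB

/-- The discharging inequality at a vertex of degree `d` that has `m` neighbors in `M`, lies in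
`k` of the four sets, and whose neighbors lie in `s` of them, counted with multiplicity. -/
theorem discharging_inequality (d m k s : ℕ) (hmd : m ≤ d) (hk : 1 ≤ k) (hk4 : k ≤ 4)
    (hms : m ≤ s) (hs : 4 ≤ k + s) :
    (4 : ℝ) + 4 / 5 * (k * m) ≤
      k * (1 + (1 / 5 : ℝ) * (min d 3 : ℕ) + 3 / 5 * d) + (if d ≤ 3 then 1 / 5 * (s : ℝ) else 0) +
        4 / 5 * s := by
  have hmd' : (m : ℝ) ≤ d := by exact_mod_cast hmd
  have hms' : (m : ℝ) ≤ s := by exact_mod_cast hms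
  have hs' : (4 : ℝ) ≤ k + s := by exact_mod_cast hs
  have hk' : (1 : ℝ) ≤ k := by exact_mod_cast hk
  have hk4' : (k : ℝ) ≤ 4 := by exact_mod_cast hk4
  split_ifs with hd
  · rw [min_eq_left hd]
    nlinarith [mul_nonneg (sub_nonneg.2 hmd') (zero_le_one.trans hk')]
  · rw [min_eq_right (by lia)]
    have hd' : (4 : ℝ) ≤ d := by exact_mod_cast (by lia : 4 ≤ d)
    push_cast
    nlinarith [mul_nonneg (sub_nonneg.2 hmd') (sub_nonneg.2 hk'),
      mul_nonneg (sub_nonneg.2 hd') (sub_nonneg.2 hk4')]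

theorem stmt_18 {V : Type*} [Fintype V] [DecidableEq V] (G : SimpleGraph V)
    (hcol : G.Colorable 4) (M : Finset V) (hM : M.Nonempty)
    (hconn : (G.induce (↑M : Set V)).Connected) :
    ∃ Vs : Fin 4 → Finset V,
      (∀ i, Vs i ⊆ M) ∧
      (∀ i, ∀ x ∈ Vs i, ∀ y ∈ Vs i, ¬ G.Adj x y) ∧
      (∀ x ∈ M, ∃ i, x ∈ Vs i) ∧
      4 * (M.card : ℝ) ≤
        ∑ i : Fin 4,
          (Phi G - Phi (G.induce (↑(Finset.univ \ Vs i) : Set V))) := by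
  classical
  obtain ⟨c⟩ := hcol
  choose Vs hcVs hVsM hind hdom using fun i : Fin 4 =>
    exists_dominating_independent G M (M.filter fun v => c v = i) (Finset.filter_subset _ _)
      (fun x hx y hy h => c.valid h
        ((Finset.mem_filter.1 hx).2.trans (Finset.mem_filter.1 hy).2.symm))
  have hcov (v : V) (hv : v ∈ M) : v ∈ Vs (c v) := hcVs _ (Finset.mem_filter.2 ⟨hv, rfl⟩)
  refine ⟨Vs, hVsM, hind, fun v hv => ⟨_, hcov v hv⟩, ?_⟩
  refine le_trans ?_ (Finset.sum_le_sum fun i _ => sum_le_Phi_sub_Phi_induce G (Vs i) (hind i))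
  let k (v : V) : ℕ := #(univ.filter fun i => v ∈ Vs i)
  let s (v : V) : ℕ := ∑ i, #(G.neighborFinset v ∩ Vs i)
  let m (v : V) : ℕ := #(G.neighborFinset v ∩ M)
  have hks : ∑ v ∈ M, s v = ∑ v ∈ M, k v * m v := by
    simp only [s, k, m, Finset.card_filter, Finset.sum_mul, ite_mul, one_mul, zero_mul]
    rw [Finset.sum_comm, Finset.sum_comm (s := M)]
    refine Finset.sum_congr rfl fun i _ => ?_
    rw [sum_card_neighborFinset_inter_comm, ← Finset.sum_filter,
      Finset.filter_mem_eq_inter, Finset.inter_eq_right.2 (hVsM i)]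
  have hms (v : V) : m v ≤ s v := by
    calc m v ≤ #(univ.biUnion fun i => G.neighborFinset v ∩ Vs i) := by
          refine Finset.card_le_card fun u hu => ?_
          rw [Finset.mem_inter] at hu
          exact Finset.mem_biUnion.2
            ⟨c u, Finset.mem_univ _, Finset.mem_inter.2 ⟨hu.1, hcov u hu.2⟩⟩
      _ ≤ s v := Finset.card_biUnion_le
  have hfour (v : V) (hv : v ∈ M) : 4 ≤ k v + s v := by
    calc 4 = ∑ _i : Fin 4, 1 := by simp
      _ ≤ ∑ i, ((if v ∈ Vs i then 1 else 0) + #(G.neighborFinset v ∩ Vs i)) := by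
          refine Finset.sum_le_sum fun i _ => ?_
          rcases hdom i v hv with h | ⟨u, hu, hvu⟩
          · simp [h]
          · have : 0 < #(G.neighborFinset v ∩ Vs i) :=
              Finset.card_pos.2 ⟨u, by simp [hu, hvu]⟩
            lia
      _ = k v + s v := by rw [Finset.sum_add_distrib, ← Finset.card_filter]
  let w (v : V) : ℝ :=
    k v * (1 + (1 / 5 : ℝ) * (min (G.degree v) 3 : ℕ) + 3 / 5 * (G.degree v : ℝ)) +
      if G.degree v ≤ 3 then 1 / 5 * (s v : ℝ) else 0
  have hw : ∑ v ∈ M, w v ≤ ∑ v, w v :=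
    Finset.sum_le_sum_of_subset_of_nonneg (Finset.subset_univ M) fun v _ _ => by
      have hnonneg (k d s : ℕ) : (0 : ℝ) ≤ k * (1 + (1 / 5 : ℝ) * (min d 3 : ℕ) + 3 / 5 * d) +
          if d ≤ 3 then 1 / 5 * (s : ℝ) else 0 := by positivity
      exact hnonneg (k v) (G.degree v) (s v)
  have hlocal : ∑ v ∈ M, ((4 : ℝ) + 4 / 5 * (k v * m v : ℝ)) ≤
      ∑ v ∈ M, (w v + 4 / 5 * (s v : ℝ)) :=
    Finset.sum_le_sum fun v hv => discharging_inequality _ _ _ _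
      (Finset.card_le_card Finset.inter_subset_left)
      (Finset.card_pos.2 ⟨c v, by simpa using hcov v hv⟩)
      ((Finset.card_le_univ _).trans (by simp)) (hms v) (hfour v hv)
  rw [Finset.sum_add_distrib, Finset.sum_add_distrib, ← Finset.mul_sum, ← Finset.mul_sum] at hlocal
  have hks' : ∑ v ∈ M, (s v : ℝ) = ∑ v ∈ M, (k v * m v : ℝ) := by exact_mod_cast hks
  rw [hks', Finset.sum_const, nsmul_eq_mul] at hlocal
  rw [Finset.sum_comm]
  refine le_trans (by linarith) (hw.trans (Finset.sum_le_sum fun v _ => le_of_eq ?_))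
  rw [Finset.sum_add_distrib, ← Finset.sum_filter, Finset.sum_const, nsmul_eq_mul]
  dsimp only [w]
  congr 1
  split_ifs
  · simp only [s, Nat.cast_sum, Finset.mul_sum]
  · simp
end
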